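/- Let Ω ⊂ ℝ^n be a bounded Boman domain with constant N ≥ 1 (with Whitney decomposition W(Ω)), let w be a doubling weight in Ω with constant D, let 1 ≤ p < ∞, and let {a_Q : Q ∈ W(Ω)} be nonnegative real numbers. Then there is a constant C = C(p, D, N) > 0 such that ‖Σ_{Q∈W(Ω)} a_Q χ_{Ω∩NQ}‖_{L^p(Ω; w dx)} ≤ C ‖Σ_{Q∈W(Ω)} a_Q χ_Q‖_{L^p(Ω; w dx)}. -/

import Mathlib

open MeasureTheory ENNReal NNReal Set

noncomputable section

/-- Euclidean space `ℝ^n`. -/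
abbrev Rn (n : ℕ) := EuclideanSpace ℝ (Fin n)

/-- The half-open cube `Q(x, r)` with midpoint `x` and side length `2r`. -/
def CubeC {n : ℕ} (x : Rn n) (r : ℝ) : Set (Rn n) :=
  {y | ∀ i, x i - r ≤ y i ∧ y i < x i + r}

/-- The weighted measure `w(E) = ∫_E w dx` of a set, as an extended nonnegative real. -/
def wMass {n : ℕ} (w : Rn n → ℝ) (E : Set (Rn n)) : ℝ≥0∞ :=
  ∫⁻ x in E, ENNReal.ofReal (w x)

/-- The measure `w dx`. -/
def wMeasure {n : ℕ} (w : Rn n → ℝ) : Measure (Rn n) :=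
  volume.withDensity fun x => ENNReal.ofReal (w x)

/-- The weighted average `u_{w;E} = w(E)⁻¹ ∫_E u w dx`. -/
def wAvg {n : ℕ} (w : Rn n → ℝ) (E : Set (Rn n)) (u : Rn n → ℝ) : ℝ :=
  ⨍ x in E, u x ∂(wMeasure w)

/-- A weight `w` is doubling in the open set `Ω` with constant `D`:
`w(Ω ∩ Q(x,2r)) ≤ D w(Ω ∩ Q(x,r))` for every cube `Q(x,r)` with midpoint `x ∈ Ω`. -/
def DoublingIn {n : ℕ} (Ω : Set (Rn n)) (w : Rn n → ℝ) (D : ℝ) : Prop :=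
  ∀ x ∈ Ω, ∀ r : ℝ, 0 < r →
    wMass w (Ω ∩ CubeC x (2 * r)) ≤ ENNReal.ofReal D * wMass w (Ω ∩ CubeC x r)

/-- The distance between two sets. -/
def setDist {n : ℕ} (A B : Set (Rn n)) : ℝ :=
  sInf {d : ℝ | ∃ x ∈ A, ∃ y ∈ B, d = dist x y}

/-- A Whitney decomposition of `Ω` with dimensional constant `Cdim`: a countable family of
pairwise disjoint half-open cubes covering `Ω`, such that the side length of each dilated
cube `Q* = (9/8)Q` is comparable (with constant `Cdim`) to its distance from `∂Ω`, and the
dilated cubes have overlap bounded by `Cdim`. -/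
structure WhitneyDecomp (n : ℕ) (Ω : Set (Rn n)) (Cdim : ℝ) where
  cubes : Set (Set (Rn n))
  countable : cubes.Countable
  center : Set (Rn n) → Rn n
  radius : Set (Rn n) → ℝ
  radius_pos : ∀ Q ∈ cubes, 0 < radius Q
  eq_cube : ∀ Q ∈ cubes, Q = CubeC (center Q) (radius Q)
  pairwise_disjoint : cubes.PairwiseDisjoint id
  union_eq : ⋃₀ cubes = Ω
  dist_lower : ∀ Q ∈ cubes,
    9 / 4 * radius Q ≤ Cdim * setDist (CubeC (center Q) (9 / 8 * radius Q)) (frontier Ω)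
  dist_upper : ∀ Q ∈ cubes,
    setDist (CubeC (center Q) (9 / 8 * radius Q)) (frontier Ω) ≤ Cdim * (9 / 4 * radius Q)
  overlap_finite : ∀ x : Rn n, {Q ∈ cubes | x ∈ CubeC (center Q) (9 / 8 * radius Q)}.Finite
  overlap_le : ∀ x : Rn n,
    (({Q ∈ cubes | x ∈ CubeC (center Q) (9 / 8 * radius Q)}).ncard : ℝ) ≤ Cdim

/-- The dilated Whitney cube `Q* = (9/8)Q`. -/
def Qstar {n : ℕ} {Ω : Set (Rn n)} {Cdim : ℝ} (W : WhitneyDecomp n Ω Cdim)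
    (Q : Set (Rn n)) : Set (Rn n) :=
  CubeC (W.center Q) (9 / 8 * W.radius Q)

/-- Two Whitney cubes `P, Q` are chained (with constant `c`) if there is a cube
`R ⊆ P* ∩ Q*` with `l(R) ≥ c · max{l(P*), l(Q*)}`. -/
def ChainLink {n : ℕ} {Ω : Set (Rn n)} {Cdim : ℝ} (W : WhitneyDecomp n Ω Cdim) (c : ℝ)
    (P Q : Set (Rn n)) : Prop :=
  ∃ (z : Rn n) (r : ℝ), 0 < r ∧ CubeC z r ⊆ Qstar W P ∩ Qstar W Q ∧
    c * max (2 * (9 / 8 * W.radius P)) (2 * (9 / 8 * W.radius Q)) ≤ 2 * r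

/-- `L` is a chain of Whitney cubes joining `P` to `Q`: a list of distinct Whitney cubes
starting at `P`, ending at `Q`, whose consecutive members are chained. -/
def IsChainFrom {n : ℕ} {Ω : Set (Rn n)} {Cdim : ℝ} (W : WhitneyDecomp n Ω Cdim) (c : ℝ)
    (P Q : Set (Rn n)) (L : List (Set (Rn n))) : Prop :=
  (∀ R ∈ L, R ∈ W.cubes) ∧ L.Nodup ∧ L.head? = some P ∧ L.getLast? = some Q ∧
    L.Chain' (ChainLink W c)

/-- A Boman chain decomposition of `Ω` with constants `Cdim` (Whitney), `cdim` (chain link)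
and `N` (Boman): a Whitney decomposition together with a chain decomposition with common
central cube such that the shadow of each `R` is contained in `NR`. -/
structure BomanDecomp (n : ℕ) (Ω : Set (Rn n)) (Cdim cdim N : ℝ)
    extends WhitneyDecomp n Ω Cdim where
  central : Set (Rn n)
  central_mem : central ∈ cubes
  chain : Set (Rn n) → List (Set (Rn n))
  chain_isChain : ∀ Q ∈ cubes, IsChainFrom toWhitneyDecomp cdim central Q (chain Q)
  shadow_subset : ∀ R ∈ cubes, ∀ Q ∈ cubes, R ∈ chain Q →
    Q ⊆ CubeC (center R) (N * radius R)

theorem ENNReal.add_rpow_le_rpow_add_mul {p : ℝ} (hp : 1 ≤ p) (x y : ℝ≥0∞) :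
    (x + y) ^ p ≤ y ^ p + ENNReal.ofReal p * (x * (x + y) ^ (p - 1)) := by
  have hp0 : 0 < p := by linarith
  rcases eq_or_ne y ∞ with rfl | hy
  · simp [ENNReal.top_rpow_of_pos hp0]
  rcases eq_or_ne x ∞ with rfl | hx
  · have h1 : (∞ : ℝ≥0∞) ^ (p - 1) ≠ 0 := by
      simp only [ne_eq, ENNReal.rpow_eq_zero_iff, top_ne_zero, false_and, true_and, false_or,
        not_lt]
      linarith
    have h2 : ENNReal.ofReal p ≠ 0 := by simpa using hp0
    simp [ENNReal.top_mul h1, ENNReal.mul_top h2]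
  lift x to ℝ≥0 using hx
  lift y to ℝ≥0 using hy
  have key : (x + y : ℝ) ^ p ≤ (y : ℝ) ^ p + p * (x * (x + y : ℝ) ^ (p - 1)) := by
    rcases (add_nonneg x.2 y.2).eq_or_lt with h | h
    · have hx : (x : ℝ) = 0 := by
        change (0 : ℝ) = x + y at h
        linarith [x.coe_nonneg, y.coe_nonneg]
      simp [hx]
    · change (0 : ℝ) < x + y at h
      have hb := one_add_mul_self_le_rpow_one_add (s := -(x / (x + y) : ℝ)) (p := p) (by
        rw [neg_le_neg_iff, div_le_one h]; linarith [y.coe_nonneg]) hp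
      have e : (1 + -(x / (x + y) : ℝ)) = y / (x + y) := by field_simp; ring
      rw [e, Real.div_rpow y.coe_nonneg h.le, le_div_iff₀ (by positivity)] at hb
      have e2 : (x + y : ℝ) ^ (p - 1) = (x + y : ℝ) ^ p / (x + y) := by
        rw [Real.rpow_sub h, Real.rpow_one]
      rw [e2]
      have : (1 + p * -(x / (x + y) : ℝ)) * (x + y : ℝ) ^ p
        = (x + y : ℝ) ^ p - p * (x * ((x + y : ℝ) ^ p / (x + y))) := by
        field_simp
        ring
      linarith
  have key' : (x + y) ^ p ≤ y ^ p + p.toNNReal * (x * (x + y) ^ (p - 1)) := by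
    rw [← NNReal.coe_le_coe]
    push_cast
    rwa [Real.coe_toNNReal _ hp0.le]
  rw [ENNReal.ofReal, ← ENNReal.coe_add, ← ENNReal.coe_rpow_of_nonneg _ hp0.le,
    ← ENNReal.coe_rpow_of_nonneg _ hp0.le, ← ENNReal.coe_rpow_of_nonneg _ (by linarith : 0 ≤ p - 1)]
  exact_mod_cast key'

theorem ENNReal.sum_rpow_le {ι : Type*} {p : ℝ} (hp : 1 ≤ p) (b : ι → ℝ≥0∞) (ρ : ι → ℝ)
    (s : Finset ι) :
    (∑ i ∈ s, b i) ^ p ≤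
      ENNReal.ofReal p * ∑ i ∈ s, b i * (∑ k ∈ s with ρ i ≤ ρ k, b k) ^ (p - 1) := by
  classical
  induction s using Finset.induction_on_min_value ρ with
  | empty => simp [show 0 < p by linarith]
  | insert a s ha hmin ih =>
    rw [Finset.sum_insert ha, Finset.sum_insert ha,
      Finset.filter_true_of_mem (by simpa using hmin), Finset.sum_insert ha, mul_add, add_comm
      (ENNReal.ofReal p * _)]
    refine (ENNReal.add_rpow_le_rpow_add_mul hp _ _).trans ?_
    gcongr
    refine ih.trans ?_
    have : 0 ≤ p - 1 := by linarith
    gcongr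
    exact Finset.subset_insert _ _

theorem ENNReal.iSup_rpow {ι : Sort*} {p : ℝ} (hp : 0 < p) (f : ι → ℝ≥0∞) :
    (⨆ i, f i) ^ p = ⨆ i, f i ^ p :=
  (ENNReal.orderIsoRpow p hp).map_iSup f

theorem ENNReal.tsum_rpow_le {ι : Type*} {p : ℝ} (hp : 1 ≤ p) (b S : ι → ℝ≥0∞) (ρ : ι → ℝ)
    (hS : ∀ i, b i ≠ 0 → ∑' k : ι, {k | ρ i ≤ ρ k}.indicator b k ≤ S i) :
    (∑' i, b i) ^ p ≤ ENNReal.ofReal p * ∑' i, b i * S i ^ (p - 1) := by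
  rw [ENNReal.tsum_eq_iSup_sum, ENNReal.iSup_rpow (by linarith)]
  refine iSup_le fun s => (ENNReal.sum_rpow_le hp b ρ s).trans ?_
  gcongr
  refine le_trans (Finset.sum_le_sum fun i _ => ?_) (ENNReal.sum_le_tsum s)
  rcases eq_or_ne (b i) 0 with hi | hi
  · simp [hi]
  have : 0 ≤ p - 1 := by linarith
  gcongr
  refine le_trans ?_ (hS i hi)
  refine le_trans (le_of_eq ?_) (ENNReal.sum_le_tsum s)
  rw [Finset.sum_filter]
  simp [Set.indicator_apply]

theorem ENNReal.rpow_inv_le_of_le_mul_rpow {p : ℝ} (hp : 1 ≤ p) {X Y C : ℝ≥0∞} (hX : X ≠ ∞)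
    (h : X ≤ C * (Y ^ (1 / p) * X ^ (1 - 1 / p))) : X ^ (1 / p) ≤ C * Y ^ (1 / p) := by
  have hp0 : 0 < p := by linarith
  rcases eq_or_ne X 0 with rfl | h0
  · simp [hp0]
  have e : X = X ^ (1 / p) * X ^ (1 - 1 / p) := by
    rw [← ENNReal.rpow_add _ _ h0 hX]; simp
  have hq : 0 ≤ 1 - 1 / p := by
    rw [sub_nonneg, div_le_one hp0]; exact hp
  rw [← ENNReal.mul_le_mul_iff_left (c := X ^ (1 - 1 / p))
    (by simp [ENNReal.rpow_eq_zero_iff, h0, hX])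
    (ENNReal.rpow_ne_top_of_nonneg hq hX), ← e]
  rwa [mul_assoc]

section Expansion

variable {X I : Type*}

/-- The sum of all the dilates `E i j`, damped by `ε ^ j`. -/
noncomputable def dampedSum (a : I → ℝ≥0∞) (E : I → ℕ → Set X) (ε : ℝ≥0∞) (x : X) : ℝ≥0∞ :=
  ∑' q : I × ℕ, (E q.1 q.2).indicator (fun _ => a q.1 * ε ^ q.2) x

theorem dampedSum_rpow_le {p : ℝ} (hp : 1 ≤ p) {a : I → ℝ≥0∞} {E : I → ℕ → Set X}
    {G : I → Set X} {ρ : I → ℕ → ℝ} {ε : ℝ≥0∞} (hε0 : ε ≠ 0) (hε : ε ≠ ∞)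
    (hGE : ∀ i j, G i ⊆ E i j)
    (hE : ∀ i j k l, ρ i j ≤ ρ k l → (E i j ∩ E k l).Nonempty → E i j ⊆ E k (l + 1)) (x : X) :
    dampedSum a E ε x ^ p ≤ ENNReal.ofReal p * ε⁻¹ ^ (p - 1) *
      ∑' q : I × ℕ, (E q.1 q.2).indicator
        (fun _ => a q.1 * ε ^ q.2 * ⨅ y ∈ G q.1, dampedSum a E ε y ^ (p - 1)) x := by
  have hp1 : 0 ≤ p - 1 := by linarith
  set S : I × ℕ → ℝ≥0∞ := fun q => ∑' r : I × ℕ, {r | ρ q.1 q.2 ≤ ρ r.1 r.2}.indicator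
      (fun r => (E r.1 r.2).indicator (fun _ => a r.1 * ε ^ r.2) x) r
  have h1 := ENNReal.tsum_rpow_le hp
    (fun q : I × ℕ => (E q.1 q.2).indicator (fun _ => a q.1 * ε ^ q.2) x) S
    (fun q => ρ q.1 q.2) (fun _ _ => le_rfl)
  refine h1.trans ?_
  rw [mul_assoc, ← ENNReal.tsum_mul_left (a := ε⁻¹ ^ (p - 1))]
  gcongr ENNReal.ofReal p * ?_
  refine ENNReal.tsum_le_tsum fun q => ?_
  by_cases hx : x ∈ E q.1 q.2
  swap
  · simp [hx]
  rw [indicator_of_mem hx, indicator_of_mem hx, mul_left_comm]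
  gcongr
  have hne : ε⁻¹ ^ (p - 1) ≠ 0 :=
    (ENNReal.rpow_pos (ENNReal.inv_pos.2 hε) (ENNReal.inv_ne_top.2 hε0)).ne'
  have hfin : ε⁻¹ ^ (p - 1) ≠ ∞ := ENNReal.rpow_ne_top_of_nonneg hp1 (ENNReal.inv_ne_top.2 hε0)
  rw [ENNReal.mul_iInf_of_ne hne hfin]
  refine le_iInf fun y => ?_
  rw [ENNReal.mul_iInf_of_ne hne hfin]
  refine le_iInf fun hy => ?_
  rw [← ENNReal.mul_rpow_of_nonneg _ _ hp1]
  gcongr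
  calc S q ≤ ∑' r : I × ℕ, ε⁻¹ *
        (E r.1 (r.2 + 1)).indicator (fun _ => a r.1 * ε ^ (r.2 + 1)) y := by
        refine ENNReal.tsum_le_tsum fun r => ?_
        by_cases hr : ρ q.1 q.2 ≤ ρ r.1 r.2
        swap
        · simp [hr]
        rw [indicator_of_mem (by exact hr)]
        by_cases hxr : x ∈ E r.1 r.2
        swap
        · simp [hxr]
        have hyr := hE _ _ _ _ hr ⟨x, hx, hxr⟩ (hGE _ q.2 hy)
        rw [indicator_of_mem hyr, indicator_of_mem hxr, pow_succ, mul_comm ε⁻¹, mul_assoc,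
          mul_assoc, ENNReal.mul_inv_cancel hε0 hε, mul_one]
    _ = ε⁻¹ * ∑' r : I × ℕ, (E r.1 (r.2 + 1)).indicator (fun _ => a r.1 * ε ^ (r.2 + 1)) y :=
        ENNReal.tsum_mul_left
    _ ≤ ε⁻¹ * dampedSum a E ε y := by
        gcongr
        exact ENNReal.tsum_comp_le_tsum_of_injective
          (f := fun r : I × ℕ => (r.1, r.2 + 1))
          (fun r s h => by simpa [Prod.ext_iff] using h)
          (fun r => (E r.1 r.2).indicator (fun _ => a r.1 * ε ^ r.2) y)

theorem dampedSum_le {a : I → ℝ≥0∞} {E : I → ℕ → Set X} {ε : ℝ≥0∞} (x : X) :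
    dampedSum a E ε x ≤ (∑' i, a i) * ∑' j, ε ^ j := by
  calc dampedSum a E ε x ≤ ∑' q : I × ℕ, a q.1 * ε ^ q.2 :=
        ENNReal.tsum_le_tsum fun q => indicator_le_self' (fun _ _ => zero_le) x
    _ = (∑' i, a i) * ∑' j, ε ^ j := by
        rw [ENNReal.tsum_prod (f := fun i j => a i * ε ^ j)]
        simp_rw [ENNReal.tsum_mul_left, ENNReal.tsum_mul_right]

variable [Countable I] [MeasurableSpace X] {μ : Measure X}

theorem measurable_dampedSum {a : I → ℝ≥0∞} {E : I → ℕ → Set X} {ε : ℝ≥0∞}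
    (hEm : ∀ i j, MeasurableSet (E i j)) : Measurable (dampedSum a E ε) :=
  Measurable.tsum fun q => measurable_const.indicator (hEm q.1 q.2)

theorem lintegral_dampedSum_rpow_le {p : ℝ} (hp : 1 ≤ p) {a : I → ℝ≥0∞} {E : I → ℕ → Set X}
    {G : I → Set X} {ρ : I → ℕ → ℝ} {K A : ℝ≥0∞} (hA1 : A ≠ 0) (hA : A ≠ ∞)
    (hGm : ∀ i, MeasurableSet (G i)) (hEm : ∀ i j, MeasurableSet (E i j))
    (hGE : ∀ i j, G i ⊆ E i j)
    (hE : ∀ i j k l, ρ i j ≤ ρ k l → (E i j ∩ E k l).Nonempty → E i j ⊆ E k (l + 1))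
    (hμ : ∀ i j, μ (E i j) ≤ K * A ^ j * μ (G i)) :
    ∫⁻ x, dampedSum a E (2 * A)⁻¹ x ^ p ∂μ ≤ ENNReal.ofReal p * (2 * A) ^ (p - 1) * (2 * K) *
      ∫⁻ x, (∑' i, (G i).indicator (fun _ => a i) x) * dampedSum a E (2 * A)⁻¹ x ^ (p - 1) ∂μ := by
  have h2A : 2 * A ≠ ∞ := ENNReal.mul_ne_top (by simp) hA
  have h2A0 : 2 * A ≠ 0 := by simpa using hA1
  have hm : Measurable (dampedSum a E (2 * A)⁻¹) := measurable_dampedSum hEm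
  set f := dampedSum a E (2 * A)⁻¹ with hf
  have h1 := fun x => dampedSum_rpow_le hp (a := a) (G := G) (ε := (2 * A)⁻¹)
    (by simpa using h2A) (by simpa using h2A0) hGE hE x
  rw [inv_inv, ← hf] at h1
  refine (lintegral_mono h1).trans ?_
  have hEm' : ∀ q : I × ℕ, Measurable ((E q.1 q.2).indicator
      (fun _ => a q.1 * (2 * A)⁻¹ ^ q.2 * ⨅ y ∈ G q.1, f y ^ (p - 1))) :=
    fun q => measurable_const.indicator (hEm q.1 q.2)
  rw [lintegral_const_mul _ (Measurable.tsum hEm'),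
    lintegral_tsum fun q => (hEm' q).aemeasurable]
  simp_rw [lintegral_indicator_const (hEm _ _)]
  rw [mul_assoc (ENNReal.ofReal p * _)]
  gcongr
  calc ∑' q : I × ℕ, a q.1 * (2 * A)⁻¹ ^ q.2 * (⨅ y ∈ G q.1, f y ^ (p - 1)) * μ (E q.1 q.2)
      ≤ ∑' q : I × ℕ, 2⁻¹ ^ q.2 * (K * (a q.1 * ((⨅ y ∈ G q.1, f y ^ (p - 1)) * μ (G q.1)))) := by
        refine ENNReal.tsum_le_tsum fun q => ?_
        calc _ ≤ a q.1 * (2 * A)⁻¹ ^ q.2 * (⨅ y ∈ G q.1, f y ^ (p - 1)) *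
              (K * A ^ q.2 * μ (G q.1)) := by gcongr; exact hμ _ _
          _ = ((2 * A)⁻¹ * A) ^ q.2 *
              (K * (a q.1 * ((⨅ y ∈ G q.1, f y ^ (p - 1)) * μ (G q.1)))) := by
              rw [mul_pow]; ring
          _ = _ := by
              rw [ENNReal.mul_inv (by simp) (by simp), mul_assoc, ENNReal.inv_mul_cancel hA1 hA,
                mul_one]
    _ = 2 * K * ∑' i, a i * ((⨅ y ∈ G i, f y ^ (p - 1)) * μ (G i)) := by
        rw [ENNReal.tsum_prod
          (f := fun i j => 2⁻¹ ^ j * (K * (a i * ((⨅ y ∈ G i, f y ^ (p - 1)) * μ (G i)))))]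
        simp_rw [ENNReal.tsum_mul_right, ENNReal.tsum_geometric_two, ENNReal.tsum_mul_left,
          mul_assoc]
    _ ≤ 2 * K * ∑' i, ∫⁻ x, (G i).indicator (fun _ => a i) x * f x ^ (p - 1) ∂μ := by
        gcongr with i
        have : ∀ x, (G i).indicator (fun _ => a i) x * f x ^ (p - 1)
            = a i * (G i).indicator (fun x => f x ^ (p - 1)) x := fun x => by
          by_cases hx : x ∈ G i <;> simp [hx]
        simp_rw [this]
        rw [lintegral_const_mul _ ((hm.pow_const _).indicator (hGm i)),
          lintegral_indicator (hGm i), ← setLIntegral_const]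
        gcongr 1
        exact setLIntegral_mono (hm.pow_const _) fun x hx => iInf₂_le x hx
    _ = _ := by
        have hGm' : ∀ i, Measurable fun x => (G i).indicator (fun _ => a i) x * f x ^ (p - 1) :=
          fun i => (measurable_const.indicator (hGm i)).mul (hm.pow_const _)
        rw [← lintegral_tsum fun i => (hGm' i).aemeasurable]
        simp_rw [ENNReal.tsum_mul_right]

theorem lintegral_tsum_indicator_rpow_le_of_summable [IsFiniteMeasure μ] {p : ℝ} (hp : 1 ≤ p)
    {a : I → ℝ≥0∞} {E : I → ℕ → Set X} {G : I → Set X} {ρ : I → ℕ → ℝ} {K A : ℝ≥0∞}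
    (hA1 : 1 ≤ A) (hA : A ≠ ∞)
    (hGm : ∀ i, MeasurableSet (G i)) (hEm : ∀ i j, MeasurableSet (E i j))
    (hGE : ∀ i j, G i ⊆ E i j)
    (hE : ∀ i j k l, ρ i j ≤ ρ k l → (E i j ∩ E k l).Nonempty → E i j ⊆ E k (l + 1))
    (hμ : ∀ i j, μ (E i j) ≤ K * A ^ j * μ (G i)) (ha : ∑' i, a i ≠ ∞) :
    (∫⁻ x, (∑' i, (E i 0).indicator (fun _ => a i) x) ^ p ∂μ) ^ (1 / p) ≤
      ENNReal.ofReal p * (2 * A) ^ (p - 1) * (2 * K) *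
        (∫⁻ x, (∑' i, (G i).indicator (fun _ => a i) x) ^ p ∂μ) ^ (1 / p) := by
  have hp0 : 0 < p := by linarith
  have hA0 : A ≠ 0 := (zero_lt_one.trans_le hA1).ne'
  set f := dampedSum a E (2 * A)⁻¹ with hf
  have hm : Measurable f := measurable_dampedSum hEm
  have hgm : Measurable fun x => ∑' i, (G i).indicator (fun _ => a i) x :=
    Measurable.tsum fun i => measurable_const.indicator (hGm i)
  have hle : ∀ x, ∑' i, (E i 0).indicator (fun _ => a i) x ≤ f x := fun x => by
    have := ENNReal.tsum_comp_le_tsum_of_injective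
      (f := fun i : I => (i, 0)) (fun r s h => by simpa [Prod.ext_iff] using h)
      (fun r : I × ℕ => (E r.1 r.2).indicator (fun _ => a r.1 * (2 * A)⁻¹ ^ r.2) x)
    simpa [hf, dampedSum] using this
  have hX : ∫⁻ x, f x ^ p ∂μ ≠ ∞ := by
    set M : ℝ≥0∞ := (∑' i, a i) * ∑' j, (2 * A)⁻¹ ^ j
    have hM : M ≠ ∞ := by
      refine ENNReal.mul_ne_top ha (ne_top_of_le_ne_top (b := ∑' j : ℕ, 2⁻¹ ^ j) ?_ ?_)
      · rw [ENNReal.tsum_geometric_two]; simp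
      · gcongr
        exact le_mul_of_one_le_right (zero_le) hA1
    refine ne_top_of_le_ne_top ?_
      (lintegral_mono fun x => ENNReal.rpow_le_rpow (dampedSum_le x) hp0.le)
    rw [lintegral_const]
    exact ENNReal.mul_ne_top (ENNReal.rpow_ne_top_of_nonneg hp0.le hM) (measure_ne_top _ _)
  refine le_trans ?_ (ENNReal.rpow_inv_le_of_le_mul_rpow hp hX ?_)
  · gcongr with x
    exact hle x
  refine (lintegral_dampedSum_rpow_le hp hA0 hA hGm hEm hGE hE hμ).trans ?_
  gcongr
  have hh := ENNReal.lintegral_mul_norm_pow_le (μ := μ) (p := 1 / p) (q := 1 - 1 / p)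
    (hgm.pow_const p).aemeasurable (hm.pow_const p).aemeasurable (by positivity)
    (by rw [sub_nonneg, div_le_one hp0]; exact hp) (by ring)
  refine le_of_eq_of_le ?_ hh
  refine lintegral_congr fun x => ?_
  rw [← ENNReal.rpow_mul, ← ENNReal.rpow_mul, mul_sub, mul_one_div_cancel hp0.ne', mul_one,
    ENNReal.rpow_one]

theorem lintegral_tsum_indicator_rpow_le [IsFiniteMeasure μ] {p : ℝ} (hp : 1 ≤ p)
    {a : I → ℝ≥0∞} {E : I → ℕ → Set X} {G : I → Set X} {ρ : I → ℕ → ℝ} {K A : ℝ≥0∞}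
    (hA1 : 1 ≤ A) (hA : A ≠ ∞)
    (hGm : ∀ i, MeasurableSet (G i)) (hEm : ∀ i j, MeasurableSet (E i j))
    (hGE : ∀ i j, G i ⊆ E i j)
    (hE : ∀ i j k l, ρ i j ≤ ρ k l → (E i j ∩ E k l).Nonempty → E i j ⊆ E k (l + 1))
    (hμ : ∀ i j, μ (E i j) ≤ K * A ^ j * μ (G i)) (ha : ∀ i, a i ≠ ∞) :
    (∫⁻ x, (∑' i, (E i 0).indicator (fun _ => a i) x) ^ p ∂μ) ^ (1 / p) ≤
      ENNReal.ofReal p * (2 * A) ^ (p - 1) * (2 * K) *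
        (∫⁻ x, (∑' i, (G i).indicator (fun _ => a i) x) ^ p ∂μ) ^ (1 / p) := by
  have hp0 : 0 < p := by linarith
  simp_rw [ENNReal.tsum_eq_iSup_sum (f := fun i => (E i 0).indicator (fun _ => a i) _),
    ENNReal.iSup_rpow hp0]
  rw [lintegral_iSup_directed
    (fun s => ((Finset.measurable_sum s fun i _ =>
      measurable_const.indicator (hEm i 0)).pow_const p).aemeasurable)
    (directed_of_isDirected_le fun s t hst x => by dsimp only; gcongr),
    ENNReal.iSup_rpow (by positivity)]
  refine iSup_le fun s => ?_
  set a' : I → ℝ≥0∞ := (s : Set I).indicator a with ha'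
  have hs : ∑' i, a' i ≠ ∞ := by
    rw [ha', ← sum_eq_tsum_indicator]
    exact ENNReal.sum_ne_top.2 fun i _ => ha i
  have h := lintegral_tsum_indicator_rpow_le_of_summable (a := a') hp hA1 hA hGm hEm hGE hE hμ hs
  refine le_trans ?_ (h.trans ?_)
  · gcongr with x
    rw [sum_eq_tsum_indicator]
    gcongr with i
    by_cases hi : i ∈ s <;> simp [hi, ha']
  · gcongr with x i
    exact indicator_le_self' (fun _ _ => zero_le) i

end Expansion

theorem measurableSet_cubeC {n : ℕ} (x : Rn n) (r : ℝ) : MeasurableSet (CubeC x r) := by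
  have : CubeC x r = ⋂ i, {y : Rn n | x i - r ≤ y i ∧ y i < x i + r} := by
    ext y; simp [CubeC]
  rw [this]
  refine MeasurableSet.iInter fun i => ?_
  have hi : Measurable fun y : Rn n => y i := (EuclideanSpace.proj i).continuous.measurable
  exact (measurableSet_le measurable_const hi).inter (measurableSet_lt hi measurable_const)

theorem mem_cubeC_self {n : ℕ} (x : Rn n) {r : ℝ} (hr : 0 < r) : x ∈ CubeC x r :=
  fun i => ⟨by linarith, by linarith⟩

theorem cubeC_subset_cubeC {n : ℕ} (x : Rn n) {r s : ℝ} (h : r ≤ s) : CubeC x r ⊆ CubeC x s :=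
  fun _ hy i => ⟨by linarith [(hy i).1], by linarith [(hy i).2]⟩

theorem cubeC_subset_of_inter_nonempty {n : ℕ} {x y : Rn n} {r s : ℝ} (hrs : r ≤ s)
    (h : (CubeC x r ∩ CubeC y s).Nonempty) : CubeC x r ⊆ CubeC y (4 * s) := by
  obtain ⟨z, hx, hy⟩ := h
  intro u hu i
  obtain ⟨h1, h2⟩ := hx i
  obtain ⟨h3, h4⟩ := hy i
  obtain ⟨h5, h6⟩ := hu i
  constructor <;> linarith

theorem wMass_mono {n : ℕ} (w : Rn n → ℝ) {s t : Set (Rn n)} (h : s ⊆ t) :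
    wMass w s ≤ wMass w t :=
  lintegral_mono_set h

theorem DoublingIn.wMass_two_pow_le {n : ℕ} {Ω : Set (Rn n)} {w : Rn n → ℝ} {D : ℝ}
    (h : DoublingIn Ω w D) {x : Rn n} (hx : x ∈ Ω) {r : ℝ} (hr : 0 < r) (k : ℕ) :
    wMass w (Ω ∩ CubeC x (2 ^ k * r)) ≤ ENNReal.ofReal D ^ k * wMass w (Ω ∩ CubeC x r) := by
  induction k with
  | zero => simp
  | succ k ih =>
    rw [pow_succ', pow_succ', mul_assoc, mul_assoc]
    exact (h x hx _ (by positivity)).trans (by gcongr)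

theorem DoublingIn.wMass_lt_top {n : ℕ} {Ω : Set (Rn n)} {w : Rn n → ℝ} {D : ℝ}
    (h : DoublingIn Ω w D) (hne : Ω.Nonempty) (hΩ : IsOpen Ω) (hb : Bornology.IsBounded Ω)
    (hw : LocallyIntegrableOn w Ω volume) : wMass w Ω < ∞ := by
  obtain ⟨x, hx⟩ := hne
  obtain ⟨U, hU, hint⟩ := hw x hx
  rw [hΩ.nhdsWithin_eq hx] at hU
  obtain ⟨r, hr, hrU⟩ : ∃ r > 0, CubeC x r ⊆ U := by
    have e : Filter.Tendsto (WithLp.toLp 2 : (Fin n → ℝ) → Rn n) (nhds (WithLp.ofLp x)) (nhds x) :=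
      (PiLp.continuous_toLp 2 fun _ : Fin n => ℝ).tendsto (WithLp.ofLp x)
    obtain ⟨ε, hε, hεU⟩ := Metric.mem_nhds_iff.1 (e hU)
    refine ⟨ε / 2, by positivity, fun y hy => ?_⟩
    refine hεU (show WithLp.ofLp y ∈ Metric.ball (WithLp.ofLp x) ε from ?_)
    rw [Metric.mem_ball, dist_pi_lt_iff hε]
    intro i
    rw [Real.dist_eq, abs_lt]
    constructor <;> linarith [(hy i).1, (hy i).2]
  obtain ⟨R, hR⟩ := hb.subset_closedBall x
  obtain ⟨k, hk⟩ := pow_unbounded_of_one_lt (R / r) (one_lt_two : (1 : ℝ) < 2)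
  rw [div_lt_iff₀ hr] at hk
  have hsub : Ω ⊆ Ω ∩ CubeC x (2 ^ k * r) := fun y hy => ⟨hy, fun i => by
    have h1 : |y i - x i| ≤ R := by
      have := (PiLp.norm_apply_le (y - x) i).trans (mem_closedBall_iff_norm.1 (hR hy))
      simpa using this
    constructor <;> linarith [(abs_le.1 h1).1, (abs_le.1 h1).2]⟩
  refine (wMass_mono w hsub).trans_lt ((h.wMass_two_pow_le hx hr k).trans_lt ?_)
  refine ENNReal.mul_lt_top (by finiteness) ?_
  refine (wMass_mono w (inter_subset_right.trans hrU)).trans_lt ?_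
  refine lt_of_le_of_lt (lintegral_mono fun y => ?_) hint.2
  rw [← ofReal_norm]
  exact ENNReal.ofReal_le_ofReal (le_abs_self _)

/-- Iwaniec–Nolder lemma: for a bounded Boman domain `Ω` with constant
`N`, a weight `w` doubling in `Ω` with constant `D`, `1 ≤ p < ∞`, and nonnegative numbers
`a_Q` indexed by the Whitney cubes,
`‖Σ_Q a_Q χ_{Ω∩NQ}‖_{L^p(Ω; w dx)} ≤ C ‖Σ_Q a_Q χ_Q‖_{L^p(Ω; w dx)}`
with `C = C(p, D, N) > 0`. -/
theorem iwaniec_nolder_expansion_lemma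
    (p D N : ℝ) (hp : 1 ≤ p) (hD : 0 < D) (hN : 1 ≤ N) :
    ∃ C : ℝ, 0 < C ∧
      ∀ (n : ℕ) (Cdim cdim : ℝ) (Ω : Set (Rn n)),
        IsOpen Ω → IsConnected Ω → Bornology.IsBounded Ω →
      ∀ B : BomanDecomp n Ω Cdim cdim N,
      ∀ w : Rn n → ℝ, LocallyIntegrableOn w Ω volume →
        (∀ᵐ x ∂(volume : Measure (Rn n)), x ∈ Ω → 0 < w x) →
        DoublingIn Ω w D →
      ∀ a : Set (Rn n) → ℝ, (∀ Q, 0 ≤ a Q) →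
        (∫⁻ x in Ω,
            (∑' Q : B.cubes, Set.indicator (Ω ∩ CubeC (B.center Q.1) (N * B.radius Q.1))
              (fun _ => ENNReal.ofReal (a Q.1)) x) ^ p * ENNReal.ofReal (w x)) ^ (1 / p) ≤
          ENNReal.ofReal C *
            (∫⁻ x in Ω,
              (∑' Q : B.cubes, Set.indicator Q.1
                (fun _ => ENNReal.ofReal (a Q.1)) x) ^ p * ENNReal.ofReal (w x)) ^ (1 / p) := by
  
  obtain ⟨m, hm⟩ := pow_unbounded_of_one_lt N (one_lt_two : (1 : ℝ) < 2)
  set A : ℝ≥0∞ := ENNReal.ofReal (max 1 D) ^ 2 with hAdef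
  have hA1 : 1 ≤ A := one_le_pow₀ (by simp)
  have hA : A ≠ ∞ := by finiteness
  set K : ℝ≥0∞ := ENNReal.ofReal D ^ m with hKdef
  set C₀ : ℝ≥0∞ := ENNReal.ofReal p * (2 * A) ^ (p - 1) * (2 * K)
  have hp0 : 0 < p := by linarith
  have h2A : 2 * A ≠ ∞ := ENNReal.mul_ne_top (by simp) hA
  have h2A0 : 2 * A ≠ 0 := by simpa using (zero_lt_one.trans_le hA1).ne'
  have hCtop : C₀ ≠ ∞ :=
    ENNReal.mul_ne_top (ENNReal.mul_ne_top ENNReal.ofReal_ne_top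
      (ENNReal.rpow_ne_top_of_nonneg (by linarith) h2A))
      (ENNReal.mul_ne_top (by simp) (by finiteness))
  have hC0 : C₀ ≠ 0 :=
    mul_ne_zero (mul_ne_zero (by simpa using hp0)
      (ENNReal.rpow_pos (pos_iff_ne_zero.2 h2A0) h2A).ne') (mul_ne_zero (by simp) (pow_ne_zero _ (by simpa using hD)))
  refine ⟨C₀.toReal, ENNReal.toReal_pos hC0 hCtop, ?_⟩
  intro n Cdim cdim Ω hΩ hconn hb B w hw _ hdoub a _
  rw [ENNReal.ofReal_toReal hCtop]
  have hsub : ∀ Q ∈ B.cubes, Q ⊆ Ω := fun Q hQ => B.union_eq ▸ subset_sUnion_of_mem hQ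
  have hcen : ∀ Q ∈ B.cubes, B.center Q ∈ Q := fun Q hQ => by
    have := mem_cubeC_self (B.center Q) (B.radius_pos Q hQ)
    rwa [← B.eq_cube Q hQ] at this
  have hQm : ∀ Q ∈ B.cubes, MeasurableSet Q := fun Q hQ => by
    rw [B.eq_cube Q hQ]; exact measurableSet_cubeC _ _
  have : Countable B.cubes := B.countable.to_subtype
  have hwm : AEMeasurable (fun x => ENNReal.ofReal (w x)) (volume.restrict Ω) :=
    hw.aestronglyMeasurable.aemeasurable.ennreal_ofReal
  set μ : Measure (Rn n) := (volume.restrict Ω).withDensity fun x => ENNReal.ofReal (w x) with hμ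
  have hμapp : ∀ s, MeasurableSet s → s ⊆ Ω → μ s = wMass w s := fun s hs hsΩ => by
    rw [hμ, withDensity_apply _ hs, Measure.restrict_restrict hs, inter_eq_left.2 hsΩ, wMass]
  have : IsFiniteMeasure μ :=
    isFiniteMeasure_withDensity (hdoub.wMass_lt_top hconn.nonempty hΩ hb hw).ne
  set E : B.cubes → ℕ → Set (Rn n) := fun Q j =>
    Ω ∩ CubeC (B.center Q.1) (4 ^ j * (N * B.radius Q.1)) with hEdef
  have hEm : ∀ Q j, MeasurableSet (E Q j) := fun Q j =>
    hΩ.measurableSet.inter (measurableSet_cubeC _ _)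
  have key := lintegral_tsum_indicator_rpow_le (μ := μ) (I := B.cubes) hp
    (a := fun Q => ENNReal.ofReal (a Q.1)) (E := E) (G := fun Q => Q.1) (K := K)
    (ρ := fun Q j => 4 ^ j * (N * B.radius Q.1)) hA1 hA (fun Q => hQm Q.1 Q.2) hEm ?_ ?_ ?_
    (fun _ => ENNReal.ofReal_ne_top)
  · have hconv : ∀ f : Rn n → ℝ≥0∞, Measurable f →
        ∫⁻ x, f x ∂μ = ∫⁻ x in Ω, f x * ENNReal.ofReal (w x) := fun f hf => by
      rw [hμ, lintegral_withDensity_eq_lintegral_mul₀ hwm hf.aemeasurable]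
      simp only [Pi.mul_apply, mul_comm]
    rw [hconv, hconv] at key
    · simpa only [hEdef, pow_zero, one_mul] using key
    · exact (Measurable.tsum fun Q : B.cubes => measurable_const.indicator (hQm Q.1 Q.2)).pow_const p
    · exact (Measurable.tsum fun Q : B.cubes => measurable_const.indicator (hEm Q 0)).pow_const p
  · rintro ⟨Q, hQ⟩ j
    refine subset_inter (hsub Q hQ) ?_
    refine (B.eq_cube Q hQ).subset.trans (cubeC_subset_cubeC _ ?_)
    have h4 : (1 : ℝ) ≤ 4 ^ j * N := by
      nlinarith [one_le_pow₀ (by norm_num : (1 : ℝ) ≤ 4) (n := j)]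
    nlinarith [B.radius_pos Q hQ]
  · rintro Q j R l hle hne
    refine subset_inter inter_subset_left (inter_subset_right.trans ?_)
    rw [pow_succ', mul_assoc]
    exact cubeC_subset_of_inter_nonempty hle
      (hne.mono (inter_subset_inter inter_subset_right inter_subset_right))
  · rintro ⟨Q, hQ⟩ j
    have hr := B.radius_pos Q hQ
    have hc := hsub Q hQ (hcen Q hQ)
    have e : Q = Ω ∩ CubeC (B.center Q) (B.radius Q) := by
      rw [← B.eq_cube Q hQ, inter_eq_right.2 (hsub Q hQ)]
    rw [hμapp _ (hEm _ _) inter_subset_left, hμapp _ (hQm Q hQ) (hsub Q hQ)]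
    calc wMass w (E ⟨Q, hQ⟩ j)
        ≤ wMass w (Ω ∩ CubeC (B.center Q) (2 ^ (m + 2 * j) * B.radius Q)) := by
          refine wMass_mono w (inter_subset_inter_right _ (cubeC_subset_cubeC _ ?_))
          rw [pow_add, pow_mul, ← mul_assoc, mul_comm (2 ^ m)]
          norm_num only
          gcongr
      _ ≤ ENNReal.ofReal D ^ (m + 2 * j) * wMass w (Ω ∩ CubeC (B.center Q) (B.radius Q)) :=
          hdoub.wMass_two_pow_le hc hr _
      _ ≤ K * A ^ j * wMass w Q := by
          rw [← e, pow_add, pow_mul, hKdef, hAdef]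
          gcongr
          exact le_max_right _ _
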